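/- For every valuation ν ∈ 𝒱₀ and all f1, f2, f3 ∈ k[Q], one has ν(j(f1,f2,f3)) ≥ ν(f1) + ν(f2) + ν(f3) − ν(xt), with the convention ν(0) = +∞ (so the inequality holds trivially if j(f1,f2,f3) = 0). -/

import Mathlib

noncomputable section

open MvPolynomial

/-- The polynomial `q = xt - yz` in `k[x,y,z,t]` (variables `x,y,z,t` are `X 0, X 1, X 2, X 3`). -/
def qpoly (k : Type) [Field k] : MvPolynomial (Fin 4) k :=
  X 0 * X 3 - X 1 * X 2

/-- The coordinate ring `k[Q] = k[x,y,z,t]/(xt - yz - 1)` of the affine quadric threefold. -/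
abbrev QuadRing (k : Type) [Field k] : Type :=
  MvPolynomial (Fin 4) k ⧸ Ideal.span {qpoly k - 1}

/-- The canonical projection `π : k[x,y,z,t] → k[Q]`. -/
def qmk (k : Type) [Field k] : MvPolynomial (Fin 4) k →+* QuadRing k :=
  Ideal.Quotient.mk (Ideal.span {qpoly k - 1})

/-- A valuation on a commutative `k`-algebra `A`, with values in `ℝ ∪ {+∞}`:
`ν⁻¹({+∞}) = {0}`, `ν(a) = 0` for `a ∈ k*`, `ν(fg) = ν f + ν g`, and
`ν(f + g) ≥ min (ν f) (ν g)`. -/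
def IsValuation (k : Type) [Field k] (A : Type) [CommRing A] [Algebra k A]
    (ν : A → WithTop ℝ) : Prop :=
  (∀ f : A, ν f = ⊤ ↔ f = 0) ∧
  (∀ a : k, a ≠ 0 → ν (algebraMap k A a) = 0) ∧
  (∀ f g : A, ν (f * g) = ν f + ν g) ∧
  (∀ f g : A, min (ν f) (ν g) ≤ ν (f + g))

/-- The monomial valuation `ν_p^α` on `k[x,y,z,t]` at the point `p` with weights `α`:
the minimum of `⟨I, α⟩` over the exponents `I` appearing in the expansion of `R` in the
shifted variables `x - p₀, y - p₁, z - p₂, t - p₃` (and `+∞` on the zero polynomial). -/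
def mvalP (k : Type) [Field k] (p : Fin 4 → k) (α : Fin 4 → ℝ)
    (R : MvPolynomial (Fin 4) k) : WithTop ℝ :=
  (MvPolynomial.aeval (fun i => X i + C (p i)) R : MvPolynomial (Fin 4) k).support.inf
    fun I => ((∑ i, α i * (I i : ℝ) : ℝ) : WithTop ℝ)

/-- The monomial valuation `ν_0^α` on `k[x,y,z,t]` at the origin with weights `α`. -/
def mvalO (k : Type) [Field k] (α : Fin 4 → ℝ)
    (R : MvPolynomial (Fin 4) k) : WithTop ℝ :=
  R.support.inf fun I => ((∑ i, α i * (I i : ℝ) : ℝ) : WithTop ℝ)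

/-- The map `ν : k[Q] → ℝ ∪ {+∞}` given by `ν(f) = sup {ν_p^α(R) : π R = f}`. -/
def nuSup (k : Type) [Field k] (p : Fin 4 → k) (α : Fin 4 → ℝ)
    (f : QuadRing k) : WithTop ℝ :=
  sSup {v : WithTop ℝ | ∃ R : MvPolynomial (Fin 4) k, qmk k R = f ∧ mvalP k p α R = v}

/-- The set `𝒱₀` of valuations on `k[Q]` obtained from monomial valuations at points
`p ∈ k⁴` with weights `α ∈ (ℝ^{<0})⁴` satisfying `α₀ + α₃ = α₁ + α₂`. -/
def V0 (k : Type) [Field k] : Set (QuadRing k → WithTop ℝ) :=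
  {ν | ∃ (p : Fin 4 → k) (α : Fin 4 → ℝ),
      (∀ i, α i < 0) ∧ α 0 + α 3 = α 1 + α 2 ∧ ν = nuSup k p α}

/-- The Jacobian determinant `Jac(R₁,R₂,R₃,R₄)` of four polynomials in `k[x,y,z,t]`. -/
def jac (k : Type) [Field k] (R : Fin 4 → MvPolynomial (Fin 4) k) :
    MvPolynomial (Fin 4) k :=
  (Matrix.of fun i j : Fin 4 => MvPolynomial.pderiv j (R i)).det

/-- The monomial valuation on `k[X,Y]` with weights `w = (w₁, w₂)`. -/
def mval2 (k : Type) [Field k] (w : Fin 2 → ℝ)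
    (R : MvPolynomial (Fin 2) k) : WithTop ℝ :=
  R.support.inf fun I => ((∑ i, w i * (I i : ℝ) : ℝ) : WithTop ℝ)

open Classical in
/-- The `(w₁,w₂)`-leading part of `R ∈ k[X,Y]`: the sum of the terms of `R` whose
weighted degree realizes the monomial valuation of `R` with weights `w`. -/
def leadPart2 (k : Type) [Field k] (w : Fin 2 → ℝ) (R : MvPolynomial (Fin 2) k) :
    MvPolynomial (Fin 2) k :=
  ∑ I ∈ R.support.filter
      (fun I => ((∑ i, w i * (I i : ℝ) : ℝ) : WithTop ℝ) = mval2 k w R),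
    monomial I (R.coeff I)

open Classical in
/-- The `α`-leading part `R^w` of `R ∈ k[x,y,z,t]` (with respect to the monomial
valuation at the origin with weights `α`). -/
def leadPart4 (k : Type) [Field k] (α : Fin 4 → ℝ) (R : MvPolynomial (Fin 4) k) :
    MvPolynomial (Fin 4) k :=
  ∑ I ∈ R.support.filter
      (fun I => ((∑ i, α i * (I i : ℝ) : ℝ) : WithTop ℝ) = mvalO k α R),
    monomial I (R.coeff I)

/-- `(f₁, f₂)` is a component of an automorphism of `Q`: there is a `k`-algebra
automorphism `σ` of `k[Q]` with `σ x = f₁` and `σ y = f₂`. -/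
def IsComponent (k : Type) [Field k] (f1 f2 : QuadRing k) : Prop :=
  ∃ σ : QuadRing k ≃ₐ[k] QuadRing k, σ (qmk k (X 0)) = f1 ∧ σ (qmk k (X 1)) = f2

/-- `(f₁, f₂)` is critically resonant with respect to `ν`. -/
def CriticallyResonant (k : Type) [Field k] (ν : QuadRing k → WithTop ℝ)
    (f1 f2 : QuadRing k) : Prop :=
  (∃ (m : ℕ) (lam : k), 1 ≤ m ∧ lam ≠ 0 ∧
      ν f1 < ν (f1 - algebraMap k (QuadRing k) lam * f2 ^ m) ∧ ν f1 = m • ν f2) ∨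
  (∃ (m : ℕ) (lam : k), 1 ≤ m ∧ lam ≠ 0 ∧
      ν f2 < ν (f2 - algebraMap k (QuadRing k) lam * f1 ^ m) ∧ ν f2 = m • ν f1)

section WeightFiltration

variable {k : Type} [Field k] {α : Fin 4 → ℝ}

/-- The subspace of polynomials all of whose exponents have `α`-weight at least `c`. -/
def weightGE (k : Type) [Field k] (α : Fin 4 → ℝ) (c : ℝ) :
    Submodule k (MvPolynomial (Fin 4) k) :=
  restrictSupport k {I | c ≤ ∑ i, α i * (I i : ℝ)}

theorem mem_weightGE {c : ℝ} {R : MvPolynomial (Fin 4) k} :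
    R ∈ weightGE k α c ↔ ∀ I, R.coeff I ≠ 0 → c ≤ ∑ i, α i * (I i : ℝ) := by
  simp [weightGE, mem_restrictSupport_iff, Set.subset_def]

theorem weightGE_anti {c d : ℝ} (h : c ≤ d) : weightGE k α d ≤ weightGE k α c :=
  fun _ hR => mem_weightGE.2 fun I hI => h.trans (mem_weightGE.1 hR I hI)

theorem monomial_mem_weightGE {I : Fin 4 →₀ ℕ} {a : k} {c : ℝ}
    (h : c ≤ ∑ i, α i * (I i : ℝ)) : monomial I a ∈ weightGE k α c := by
  classical
  refine mem_weightGE.2 fun J hJ => ?_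
  rw [coeff_monomial] at hJ
  split_ifs at hJ with hIJ
  · exact hIJ ▸ h
  · exact absurd rfl hJ

theorem X_mem_weightGE (i : Fin 4) : (X i : MvPolynomial (Fin 4) k) ∈ weightGE k α (α i) :=
  monomial_mem_weightGE (by simp [Finsupp.single_apply])

theorem C_mem_weightGE {c : ℝ} (hc : c ≤ 0) (a : k) : C a ∈ weightGE k α c :=
  monomial_mem_weightGE (by simpa using hc)

theorem mul_mem_weightGE {c d : ℝ} {R S : MvPolynomial (Fin 4) k}
    (hR : R ∈ weightGE k α c) (hS : S ∈ weightGE k α d) : R * S ∈ weightGE k α (c + d) := by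
  classical
  refine mem_weightGE.2 fun I hI => ?_
  obtain ⟨J, hJ, L, hL, rfl⟩ := Finset.mem_add.1 (support_mul R S (mem_support_iff.2 hI))
  have := mem_weightGE.1 hR J (mem_support_iff.1 hJ)
  have := mem_weightGE.1 hS L (mem_support_iff.1 hL)
  simp only [Finsupp.add_apply, Nat.cast_add, mul_add, Finset.sum_add_distrib]
  linarith

theorem prod_mem_weightGE {ι : Type*} (s : Finset ι) {c : ι → ℝ}
    {R : ι → MvPolynomial (Fin 4) k} (h : ∀ i ∈ s, R i ∈ weightGE k α (c i)) :
    ∏ i ∈ s, R i ∈ weightGE k α (∑ i ∈ s, c i) := by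
  classical
  induction s using Finset.induction_on with
  | empty => simpa using C_mem_weightGE (α := α) le_rfl (1 : k)
  | insert a s ha ih =>
    rw [Finset.prod_insert ha, Finset.sum_insert ha]
    exact mul_mem_weightGE (h a (s.mem_insert_self a))
      (ih fun i hi => h i (Finset.mem_insert_of_mem hi))

theorem pderiv_mem_weightGE {c : ℝ} {R : MvPolynomial (Fin 4) k} (hR : R ∈ weightGE k α c)
    (j : Fin 4) : pderiv j R ∈ weightGE k α (c - α j) := by
  rw [R.as_sum, map_sum]
  refine Submodule.sum_mem _ fun I hI => ?_
  rw [pderiv_monomial]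
  by_cases hj : I j = 0
  · simp [hj]
  refine monomial_mem_weightGE ?_
  have hle : Finsupp.single j 1 ≤ I := by
    simpa [Finsupp.single_le_iff] using Nat.one_le_iff_ne_zero.2 hj
  have hc := mem_weightGE.1 hR I (mem_support_iff.1 hI)
  rw [← tsub_add_cancel_of_le hle] at hc
  simp only [Finsupp.add_apply, Nat.cast_add, mul_add, Finset.sum_add_distrib] at hc
  simp [Finsupp.single_apply] at hc ⊢
  linarith

theorem jac_mem_weightGE {c : Fin 4 → ℝ} {R : Fin 4 → MvPolynomial (Fin 4) k}
    (hR : ∀ i, R i ∈ weightGE k α (c i)) :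
    jac k R ∈ weightGE k α (∑ i, c i - ∑ i, α i) := by
  rw [jac, Matrix.det_apply]
  refine Submodule.sum_mem _ fun σ _ => ?_
  have h : ∏ i, (Matrix.of fun i j : Fin 4 => pderiv j (R i)) (σ i) i
      ∈ weightGE k α (∑ i, (c (σ i) - α i)) :=
    prod_mem_weightGE _ fun i _ => pderiv_mem_weightGE (hR (σ i)) i
  rw [Finset.sum_sub_distrib, Equiv.sum_comp σ c] at h
  rcases Int.units_eq_one_or (Equiv.Perm.sign σ) with hs | hs <;> rw [hs]
  · simpa using h
  · simpa using h

end WeightFiltration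

section Translation

variable {k : Type} [Field k] {p : Fin 4 → k} {α : Fin 4 → ℝ}

theorem coe_le_mvalP_iff {c : ℝ} {R : MvPolynomial (Fin 4) k} :
    (c : WithTop ℝ) ≤ mvalP k p α R ↔
      (aeval (fun i => X i + C (p i)) R : MvPolynomial (Fin 4) k) ∈ weightGE k α c := by
  simp only [mvalP, mem_weightGE, Finset.le_inf_iff, mem_support_iff, WithTop.coe_le_coe]

theorem pderiv_aeval_X_add_C (j : Fin 4) (R : MvPolynomial (Fin 4) k) :
    pderiv j (aeval (fun i => X i + C (p i)) R : MvPolynomial (Fin 4) k) =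
      aeval (fun i => X i + C (p i)) (pderiv j R) := by
  classical
  induction R using MvPolynomial.induction_on with
  | C a => simp [algebraMap_eq]
  | add R S hR hS => simp only [map_add, hR, hS]
  | mul_X R i hR =>
    simp only [map_mul, aeval_X, Derivation.leibniz, hR, map_add, pderiv_C, pderiv_X, add_zero,
      smul_eq_mul]
    by_cases h : i = j
    · subst h; simp
    · simp [h]

theorem aeval_X_add_C_ne_zero {R : MvPolynomial (Fin 4) k} (hR : R ≠ 0) :
    (aeval (fun i => X i + C (p i)) R : MvPolynomial (Fin 4) k) ≠ 0 := by
  intro h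
  have hcomp : (aeval fun i => X i - C (p i)).comp (aeval fun i => X i + C (p i)) =
      AlgHom.id k (MvPolynomial (Fin 4) k) := by
    ext1 i
    simp [algebraMap_eq]
  apply hR
  rw [← AlgHom.id_apply (R := k) R, ← hcomp, AlgHom.comp_apply, h, map_zero]

theorem mvalP_le_zero (hα : ∀ i, α i < 0) {R : MvPolynomial (Fin 4) k} (hR : R ≠ 0) :
    mvalP k p α R ≤ 0 := by
  obtain ⟨I, hI⟩ := support_nonempty.2 (aeval_X_add_C_ne_zero (p := p) hR)
  refine (Finset.inf_le hI).trans ?_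
  exact_mod_cast Finset.sum_nonpos fun i _ =>
    mul_nonpos_of_nonpos_of_nonneg (hα i).le (Nat.cast_nonneg (I i))

theorem aeval_jac (R : Fin 4 → MvPolynomial (Fin 4) k) :
    (aeval (fun i => X i + C (p i)) (jac k R) : MvPolynomial (Fin 4) k) =
      jac k fun i => aeval (fun i => X i + C (p i)) (R i) := by
  rw [jac, AlgHom.map_det, jac]
  congr 1
  ext1 i j
  exact (pderiv_aeval_X_add_C j (R i)).symm

theorem coe_le_mvalP_mul_X_X {i j : Fin 4} (hi : α i < 0) (hj : α j < 0) :
    ((α i + α j : ℝ) : WithTop ℝ) ≤ mvalP k p α (X i * X j) := by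
  have h (l : Fin 4) (hl : α l < 0) : X l + C (p l) ∈ weightGE k α (α l) :=
    Submodule.add_mem _ (X_mem_weightGE l) (C_mem_weightGE hl.le _)
  rw [coe_le_mvalP_iff]
  simpa using mul_mem_weightGE (h i hi) (h j hj)

theorem coe_le_mvalP_qpoly (hα : ∀ i, α i < 0) (h : α 0 + α 3 = α 1 + α 2) :
    ((α 0 + α 3 : ℝ) : WithTop ℝ) ≤ mvalP k p α (qpoly k) := by
  rw [coe_le_mvalP_iff, qpoly, map_sub]
  refine Submodule.sub_mem _ (coe_le_mvalP_iff.1 (coe_le_mvalP_mul_X_X (hα 0) (hα 3))) ?_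
  rw [h]
  exact coe_le_mvalP_iff.1 (coe_le_mvalP_mul_X_X (hα 1) (hα 2))

theorem coe_le_mvalP_jac (hα : ∀ i, α i < 0) (h : α 0 + α 3 = α 1 + α 2) {c1 c2 c3 : ℝ}
    {R1 R2 R3 : MvPolynomial (Fin 4) k} (h1 : c1 ≤ mvalP k p α R1)
    (h2 : c2 ≤ mvalP k p α R2) (h3 : c3 ≤ mvalP k p α R3) :
    ((c1 + c2 + c3 - (α 0 + α 3) : ℝ) : WithTop ℝ) ≤
      mvalP k p α (jac k ![qpoly k, R1, R2, R3]) := by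
  rw [coe_le_mvalP_iff, aeval_jac]
  have hc : ∀ i, (aeval (fun i => X i + C (p i)) (![qpoly k, R1, R2, R3] i) :
      MvPolynomial (Fin 4) k) ∈ weightGE k α (![α 0 + α 3, c1, c2, c3] i) := by
    intro i
    fin_cases i
    · exact coe_le_mvalP_iff.1 (coe_le_mvalP_qpoly hα h)
    · exact coe_le_mvalP_iff.1 h1
    · exact coe_le_mvalP_iff.1 h2
    · exact coe_le_mvalP_iff.1 h3
  refine weightGE_anti (le_of_eq ?_) (jac_mem_weightGE hc)
  simp only [Fin.sum_univ_four, Matrix.cons_val]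
  linarith

end Translation

section Quotient

variable {k : Type} [Field k] {p : Fin 4 → k} {α : Fin 4 → ℝ}

theorem exists_pderiv_eq_of_qmk_eq {R S : MvPolynomial (Fin 4) k} (h : qmk k R = qmk k S) :
    ∃ a : QuadRing k, ∀ j,
      qmk k (pderiv j R) = qmk k (pderiv j S) + a * qmk k (pderiv j (qpoly k)) := by
  obtain ⟨A, hA⟩ := Ideal.mem_span_singleton'.1 (Ideal.Quotient.eq.1 h)
  have hq : qmk k (qpoly k - 1) = 0 :=
    Ideal.Quotient.eq_zero_iff_mem.2 (Ideal.mem_span_singleton_self _)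
  refine ⟨qmk k A, fun j => ?_⟩
  rw [eq_add_of_sub_eq' hA.symm]
  simp only [map_add, Derivation.leibniz, smul_eq_mul, map_mul, hq, map_sub, pderiv_one, sub_zero]
  ring

theorem qmk_jac_congr {R1 R2 R3 S1 S2 S3 : MvPolynomial (Fin 4) k} (h1 : qmk k R1 = qmk k S1)
    (h2 : qmk k R2 = qmk k S2) (h3 : qmk k R3 = qmk k S3) :
    qmk k (jac k ![qpoly k, R1, R2, R3]) = qmk k (jac k ![qpoly k, S1, S2, S3]) := by
  obtain ⟨a1, ha1⟩ := exists_pderiv_eq_of_qmk_eq h1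
  obtain ⟨a2, ha2⟩ := exists_pderiv_eq_of_qmk_eq h2
  obtain ⟨a3, ha3⟩ := exists_pderiv_eq_of_qmk_eq h3
  rw [jac, jac, RingHom.map_det, RingHom.map_det]
  refine Matrix.det_eq_of_forall_row_eq_smul_add_const ![0, a1, a2, a3] 0 rfl fun i j => ?_
  fin_cases i
  · simp
  · simpa using ha1 j
  · simpa using ha2 j
  · simpa using ha3 j

theorem qmk_X_zero_mul_X_three_ne_zero : qmk k (X 0 * X 3) ≠ 0 := by
  intro h
  obtain ⟨A, hA⟩ := Ideal.mem_span_singleton'.1 (Ideal.Quotient.eq_zero_iff_mem.1 h)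
  simpa [qpoly] using congrArg (eval ![1, 0, 0, 1]) hA

theorem isLUB_nuSup (f : QuadRing k) :
    IsLUB {v : WithTop ℝ | ∃ R : MvPolynomial (Fin 4) k, qmk k R = f ∧ mvalP k p α R = v}
      (nuSup k p α f) := by
  obtain ⟨R, hR⟩ := Ideal.Quotient.mk_surjective f
  exact WithTop.isLUB_sSup' ⟨_, R, hR, rfl⟩

theorem mvalP_le_nuSup (R : MvPolynomial (Fin 4) k) : mvalP k p α R ≤ nuSup k p α (qmk k R) :=
  (isLUB_nuSup _).1 ⟨R, rfl, rfl⟩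

theorem exists_lt_mvalP_of_lt_nuSup {f : QuadRing k} {c : WithTop ℝ} (h : c < nuSup k p α f) :
    ∃ R, qmk k R = f ∧ c < mvalP k p α R := by
  obtain ⟨_, ⟨R, hR, rfl⟩, hc⟩ := (lt_isLUB_iff (isLUB_nuSup f)).1 h
  exact ⟨R, hR, hc⟩

theorem nuSup_le_zero (hα : ∀ i, α i < 0) {f : QuadRing k} (hf : f ≠ 0) :
    nuSup k p α f ≤ 0 := by
  refine (isLUB_nuSup f).2 ?_
  rintro _ ⟨R, rfl, rfl⟩
  exact mvalP_le_zero hα fun h => hf (by rw [h, map_zero])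

theorem coe_le_nuSup_jac (hα : ∀ i, α i < 0) (h : α 0 + α 3 = α 1 + α 2) {c1 c2 c3 : ℝ}
    {R1 R2 R3 : MvPolynomial (Fin 4) k} (h1 : c1 < nuSup k p α (qmk k R1))
    (h2 : c2 < nuSup k p α (qmk k R2)) (h3 : c3 < nuSup k p α (qmk k R3)) :
    ((c1 + c2 + c3 - (α 0 + α 3) : ℝ) : WithTop ℝ) ≤
      nuSup k p α (qmk k (jac k ![qpoly k, R1, R2, R3])) := by
  obtain ⟨S1, hS1, hc1⟩ := exists_lt_mvalP_of_lt_nuSup h1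
  obtain ⟨S2, hS2, hc2⟩ := exists_lt_mvalP_of_lt_nuSup h2
  obtain ⟨S3, hS3, hc3⟩ := exists_lt_mvalP_of_lt_nuSup h3
  rw [← qmk_jac_congr hS1 hS2 hS3]
  exact (coe_le_mvalP_jac hα h hc1.le hc2.le hc3.le).trans (mvalP_le_nuSup _)

end Quotient

theorem WithTop.add_add_le_of_forall_lt {a b c : WithTop ℝ} {r : ℝ}
    (h : ∀ x y z : ℝ, x < a → y < b → z < c → x + y + z ≤ r) : a + b + c ≤ r := by
  have hex (u : WithTop ℝ) : ∃ x : ℝ, x < u := by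
    induction u with
    | top => exact ⟨0, WithTop.coe_lt_top 0⟩
    | coe u => exact ⟨u - 1, WithTop.coe_lt_coe.2 (sub_one_lt u)⟩
  obtain ⟨x, hx⟩ := hex a
  obtain ⟨y, hy⟩ := hex b
  obtain ⟨z, hz⟩ := hex c
  induction a with
  | top => linarith [h (r - y - z + 1) y z (WithTop.coe_lt_top _) hy hz]
  | coe a =>
  induction b with
  | top => linarith [h x (r - x - z + 1) z hx (WithTop.coe_lt_top _) hz]
  | coe b =>
  induction c with
  | top => linarith [h x y (r - x - y + 1) hx hy (WithTop.coe_lt_top _)]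
  | coe c =>
  norm_cast at h ⊢
  refine le_of_forall_pos_le_add fun ε hε => ?_
  linarith [h (a - ε / 3) (b - ε / 3) (c - ε / 3) (by linarith) (by linarith) (by linarith)]


/-- Lemma 4.9: for every `ν ∈ 𝒱₀` and all `f₁, f₂, f₃ ∈ k[Q]`, the
pseudo-jacobian `j(f₁,f₂,f₃) = π(Jac(q,R₁,R₂,R₃))` (for any lifts `Rᵢ` of `fᵢ`)
satisfies `ν(j(f₁,f₂,f₃)) ≥ ν(f₁) + ν(f₂) + ν(f₃) - ν(xt)`. -/
theorem val_pseudoJacobian_ge (k : Type) [Field k] [IsAlgClosed k] [CharZero k]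
    (ν : QuadRing k → WithTop ℝ) (hν : ν ∈ V0 k)
    (f1 f2 f3 : QuadRing k)
    (R1 R2 R3 : MvPolynomial (Fin 4) k)
    (h1 : qmk k R1 = f1) (h2 : qmk k R2 = f2) (h3 : qmk k R3 = f3) :
    ν f1 + ν f2 + ν f3 - ν (qmk k (X 0 * X 3))
      ≤ ν (qmk k (jac k ![qpoly k, R1, R2, R3])) := by
  obtain ⟨p, α, hα, h, rfl⟩ := hν
  subst h1 h2 h3
  have hxt : ((α 0 + α 3 : ℝ) : WithTop ℝ) ≤ nuSup k p α (qmk k (X 0 * X 3)) :=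
    (coe_le_mvalP_mul_X_X (hα 0) (hα 3)).trans (mvalP_le_nuSup _)
  obtain ⟨s, hs⟩ := WithTop.ne_top_iff_exists.1
    ((nuSup_le_zero (p := p) hα (qmk_X_zero_mul_X_three_ne_zero (k := k))).trans_lt
      (WithTop.coe_lt_top 0)).ne
  rw [← hs, WithTop.coe_le_coe] at hxt
  rw [← hs]
  rcases eq_or_ne (nuSup k p α (qmk k (jac k ![qpoly k, R1, R2, R3]))) ⊤ with htop | htop
  · rw [htop]
    exact le_top
  obtain ⟨r, hr⟩ := WithTop.ne_top_iff_exists.1 htop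
  rw [← hr]
  have hle : nuSup k p α (qmk k R1) + nuSup k p α (qmk k R2) + nuSup k p α (qmk k R3) ≤
      ((r + s : ℝ) : WithTop ℝ) := by
    refine WithTop.add_add_le_of_forall_lt fun x y z hx hy hz => ?_
    have hxyz := coe_le_nuSup_jac hα h hx hy hz
    rw [← hr, WithTop.coe_le_coe] at hxyz
    linarith
  obtain ⟨u, hu⟩ := WithTop.ne_top_iff_exists.1 (hle.trans_lt (WithTop.coe_lt_top _)).ne
  rw [← hu, WithTop.coe_le_coe] at hle
  rw [← hu, ← WithTop.LinearOrderedAddCommGroup.coe_sub, WithTop.coe_le_coe]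
  linarith
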